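/- Let 1 ≤ k < n, S = {1,…,k}, S^c = {k+1,…,n}. There exists a bijection R̃ from {f : {1,…,n} → {1,…,n} with f(S) ⊆ S^c} to the set of doubly rooted trees (T, r1, r2) on n vertices such that S is independent in T and r2 ∈ S^c, with the property that for every such f, |N_S(T) − N_S(f)| ≤ 1, where N_S(f) is the number of vertices x ∈ S^c that are not adjacent to any vertex of S in the undirected functional graph of f (i.e., f(x) ∉ S and no s ∈ S has f(s) = x), and N_S(T) is the number of vertices x ∈ S^c that are not adjacent to any vertex of S in T. -/

import Mathlib

open scoped Classical

/-- The core of a self-map: the set of points lying on a cycle,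
i.e. `x` with `f^[j] x = x` for some `j ≥ 1`. -/
def inCore {V : Type*} (f : V → V) (x : V) : Prop := ∃ j ≥ 1, f^[j] x = x

/-- A doubly rooted tree on `n` vertices: a tree on vertex set `Fin n`
together with an ordered pair of roots. -/
structure DoublyRootedTree (n : ℕ) where
  tree : SimpleGraph (Fin n)
  isTree : tree.IsTree
  r1 : Fin n
  r2 : Fin n

/-- `NSfun n k f` : the number of vertices `x ∈ Sᶜ` not adjacent to any vertex of
`S = {x | (x : ℕ) < k}` in the undirected functional graph of `f`. -/
noncomputable def NSfun (n k : ℕ) (f : Fin n → Fin n) : ℕ :=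
  Set.ncard {x : Fin n | k ≤ (x : ℕ) ∧ k ≤ (f x : ℕ) ∧
    ∀ s : Fin n, (s : ℕ) < k → f s ≠ x}

/-- `NStree n k G` : the number of vertices `x ∈ Sᶜ` with no neighbor in
`S = {x | (x : ℕ) < k}` in the graph `G`. -/
noncomputable def NStree (n k : ℕ) (G : SimpleGraph (Fin n)) : ℕ :=
  Set.ncard {x : Fin n | k ≤ (x : ℕ) ∧ ∀ s : Fin n, (s : ℕ) < k → ¬ G.Adj x s}

section Foata

variable {V : Type*}

lemma inCore.iterate {f : V → V} {x : V} (hx : inCore f x) (k : ℕ) : inCore f (f^[k] x) := by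
  obtain ⟨j, hj, h⟩ := hx
  refine ⟨j, hj, ?_⟩
  rw [← Function.iterate_add_apply, add_comm, Function.iterate_add_apply, h]

lemma inCore.exists_iterate_eq {f : V → V} {x : V} (hx : inCore f x) (k : ℕ) :
    ∃ l, f^[l] (f^[k] x) = x := by
  obtain ⟨j, hj, h⟩ := hx
  have hk : k ≤ j * k := Nat.le_mul_of_pos_left k hj
  refine ⟨j * k - k, ?_⟩
  rw [← Function.iterate_add_apply, Nat.sub_add_cancel hk]
  exact (Function.IsPeriodicPt.mul_const (show Function.IsPeriodicPt f j x from h) k)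

lemma inCore.eq_of_apply_eq {f : V → V} {x y : V} (hx : inCore f x) (hy : inCore f y)
    (h : f x = f y) : x = y := by
  obtain ⟨i, hi, hx⟩ := hx
  obtain ⟨j, hj, hy⟩ := hy
  have hx' : f^[i * j] x = x :=
    Function.IsPeriodicPt.mul_const (show Function.IsPeriodicPt f i x from hx) j
  have hy' : f^[i * j] y = y :=
    Function.IsPeriodicPt.const_mul (show Function.IsPeriodicPt f j y from hy) i
  obtain ⟨m, hm⟩ : ∃ m, i * j = m + 1 := ⟨i * j - 1, (Nat.sub_add_cancel (Nat.mul_pos hi hj)).symm⟩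
  rw [← hx', ← hy', hm, Function.iterate_succ_apply, Function.iterate_succ_apply, h]

lemma exists_inCore_iterate [Finite V] (f : V → V) (x : V) : ∃ j, inCore f (f^[j] x) := by
  obtain ⟨i, j, hij, h⟩ := Finite.exists_ne_map_eq_of_infinite fun j : ℕ => f^[j] x
  wlog hlt : i < j generalizing i j
  · exact this j i hij.symm h.symm (by omega)
  refine ⟨i, j - i, by omega, ?_⟩
  rw [← Function.iterate_add_apply, Nat.sub_add_cancel hlt.le]
  exact h.symm

/-- `g` is the parent function of a tree rooted at `c`. -/
def IsParentFun (g : V → V) (c : V) : Prop := g c = c ∧ ∀ x, ∃ j, g^[j] x = c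

lemma IsParentFun.iterate_root {g : V → V} {c : V} (h : IsParentFun g c) (j : ℕ) :
    g^[j] c = c := Function.iterate_fixed h.1 j

lemma IsParentFun.eq_root {g : V → V} {c x : V} (h : IsParentFun g c) {m : ℕ} (hm : 1 ≤ m)
    (hx : g^[m] x = x) : x = c := by
  obtain ⟨j, hj⟩ := h.2 x
  obtain ⟨l, hl⟩ := inCore.exists_iterate_eq ⟨m, hm, hx⟩ j
  rw [← hl, hj, h.iterate_root]

lemma IsParentFun.root_unique {g : V → V} {c d : V} (h : IsParentFun g c)
    (h' : IsParentFun g d) : c = d :=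
  h'.eq_root le_rfl h.1

lemma IsParentFun.iterate_eq_root {g : V → V} {c r : V} (h : IsParentFun g c) {i j : ℕ}
    (hij : i < j) (he : g^[i] r = g^[j] r) : g^[i] r = c := by
  refine h.eq_root (m := j - i) (by omega) ?_
  rw [← Function.iterate_add_apply, Nat.sub_add_cancel hij.le, he]

variable [LinearOrder V]

/-- The minimum of `r, g r, …, g^[j] r`. -/
def pathMin (g : V → V) (r : V) : ℕ → V
  | 0 => r
  | j + 1 => min (pathMin g r j) (g^[j + 1] r)

lemma pathMin_antitone (g : V → V) (r : V) : Antitone (pathMin g r) :=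
  antitone_nat_of_succ_le fun _ => min_le_left _ _

lemma pathMin_le_iterate (g : V → V) (r : V) (j : ℕ) : pathMin g r j ≤ g^[j] r := by
  cases j with
  | zero => exact le_rfl
  | succ j => exact min_le_right _ _

lemma pathMin_succ_of_le {g : V → V} {r : V} {j : ℕ} (h : pathMin g r j ≤ g^[j + 1] r) :
    pathMin g r (j + 1) = pathMin g r j := min_eq_left h

lemma pathMin_succ_of_lt {g : V → V} {r : V} {j : ℕ} (h : g^[j + 1] r < pathMin g r j) :
    pathMin g r (j + 1) = g^[j + 1] r := min_eq_right h.le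

lemma exists_pathMin_eq (g : V → V) (r : V) (j : ℕ) :
    ∃ i ≤ j, g^[i] r = pathMin g r j ∧ pathMin g r i = pathMin g r j := by
  induction j with
  | zero => exact ⟨0, le_rfl, rfl, rfl⟩
  | succ j ih =>
    rcases lt_or_ge (g^[j + 1] r) (pathMin g r j) with h | h
    · exact ⟨j + 1, le_rfl, (pathMin_succ_of_lt h).symm, rfl⟩
    · obtain ⟨i, hi, h1, h2⟩ := ih
      rw [pathMin_succ_of_le h]
      exact ⟨i, by omega, h1, h2⟩

lemma IsParentFun.pathMin_eq_of_root {g : V → V} {c r : V} (h : IsParentFun g c) {i j : ℕ}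
    (hi : g^[i] r = c) (hij : i ≤ j) : pathMin g r j = pathMin g r i := by
  induction j, hij using Nat.le_induction with
  | base => rfl
  | succ j hij ih =>
    rw [pathMin_succ_of_le, ih]
    have : g^[j + 1] r = g^[i] r := by
      rw [show j + 1 = (j + 1 - i) + i by omega, Function.iterate_add_apply, hi, h.iterate_root]
    rw [ih, this]
    exact pathMin_le_iterate g r i

lemma IsParentFun.pathMin_congr {g : V → V} {c r : V} (h : IsParentFun g c) {i j : ℕ}
    (he : g^[i] r = g^[j] r) : pathMin g r i = pathMin g r j := by
  rcases lt_trichotomy i j with hij | rfl | hij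
  · exact (h.pathMin_eq_of_root (h.iterate_eq_root hij he) hij.le).symm
  · rfl
  · exact h.pathMin_eq_of_root (h.iterate_eq_root hij he.symm) hij.le

/-- Foata's transform: the path `r, g r, g (g r), …` is cut in front of each of its left-to-right
minima, and each piece is closed up into a cycle. -/
noncomputable def foata (g : V → V) (r y : V) : V :=
  if h : ∃ j, g^[j] r = y then
    if g y = y ∨ g y < pathMin g r (Nat.find h) then pathMin g r (Nat.find h) else g y
  else g y

lemma foata_of_not_mem {g : V → V} {r y : V} (h : ¬ ∃ j, g^[j] r = y) : foata g r y = g y :=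
  dif_neg h

lemma IsParentFun.foata_iterate {g : V → V} {c : V} (h : IsParentFun g c) (r : V) (j : ℕ) :
    foata g r (g^[j] r) = if g^[j + 1] r = g^[j] r ∨ g^[j + 1] r < pathMin g r j
      then pathMin g r j else g^[j + 1] r := by
  have hy : ∃ i, g^[i] r = g^[j] r := ⟨j, rfl⟩
  rw [foata, dif_pos hy, Function.iterate_succ_apply',
    h.pathMin_congr (Nat.find_spec hy)]

/-- `c` is the smallest element of a cycle of `f`. -/
def IsLeader (f : V → V) (c : V) : Prop := inCore f c ∧ ∀ k, c ≤ f^[k] c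

/-- `g` and `r` arise from `f` by listing the cycles of `f` in decreasing order of their minima,
each cycle starting from its minimum. -/
structure IsUnfolding (f g : V → V) (r : V) : Prop where
  greatest : IsGreatest {c | IsLeader f c} r
  eq_of_not : ∀ x, ¬ (inCore f x ∧ IsLeader f (f x)) → g x = f x
  next : ∀ x, inCore f x → IsLeader f (f x) →
    IsGreatest {c | IsLeader f c ∧ c < f x} (g x) ∨ (∀ c, IsLeader f c → f x ≤ c) ∧ g x = x

lemma IsUnfolding.unique {f g g' : V → V} {r r' : V} (h : IsUnfolding f g r)
    (h' : IsUnfolding f g' r') : g = g' ∧ r = r' := by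
  refine ⟨funext fun x => ?_, h.greatest.unique h'.greatest⟩
  by_cases hx : inCore f x ∧ IsLeader f (f x)
  · rcases h.next x hx.1 hx.2 with h1 | ⟨h1, h2⟩ <;>
      rcases h'.next x hx.1 hx.2 with h3 | ⟨h3, h4⟩
    · exact h1.unique h3
    · exact absurd h1.1.2 (h3 _ h1.1.1).not_gt
    · exact absurd h3.1.2 (h1 _ h3.1.1).not_gt
    · rw [h2, h4]
  · rw [h.eq_of_not x hx, h'.eq_of_not x hx]

lemma exists_isGreatest [Finite V] {s : Set V} (hs : s.Nonempty) : ∃ c, IsGreatest s c := by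
  obtain ⟨c, hc, h⟩ := Set.exists_max_image s id s.toFinite hs
  exact ⟨c, hc, fun x hx => h x hx⟩

lemma inCore.exists_isLeader [Finite V] {f : V → V} {x : V} (hx : inCore f x) :
    ∃ k, IsLeader f (f^[k] x) := by
  obtain ⟨c, ⟨k, rfl⟩, h⟩ := Set.exists_min_image (Set.range fun k => f^[k] x) id
    (Set.toFinite _) ⟨x, 0, rfl⟩
  refine ⟨k, hx.iterate k, fun l => ?_⟩
  exact h _ ⟨l + k, Function.iterate_add_apply f l k x⟩

lemma exists_isUnfolding [Finite V] [Nonempty V] (f : V → V) : ∃ g r, IsUnfolding f g r := by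
  obtain ⟨j, hj⟩ := exists_inCore_iterate f (Classical.arbitrary V)
  obtain ⟨k, hk⟩ := hj.exists_isLeader
  obtain ⟨r, hr⟩ := exists_isGreatest (s := {c | IsLeader f c}) ⟨_, hk⟩
  have : ∀ x, ∃ y, (¬ (inCore f x ∧ IsLeader f (f x)) → y = f x) ∧
      (inCore f x → IsLeader f (f x) → IsGreatest {c | IsLeader f c ∧ c < f x} y ∨
        (∀ c, IsLeader f c → f x ≤ c) ∧ y = x) := by
    intro x
    by_cases hx : inCore f x ∧ IsLeader f (f x)
    · by_cases hs : ({c | IsLeader f c ∧ c < f x} : Set V).Nonempty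
      · obtain ⟨y, hy⟩ := exists_isGreatest hs
        exact ⟨y, fun h => absurd hx h, fun _ _ => Or.inl hy⟩
      · exact ⟨x, fun h => absurd hx h, fun _ _ =>
          Or.inr ⟨fun c hc => not_lt.1 fun hlt => hs ⟨c, hc, hlt⟩, rfl⟩⟩
    · exact ⟨f x, fun _ => rfl, fun h1 h2 => absurd ⟨h1, h2⟩ hx⟩
  choose g hg using this
  exact ⟨g, r, hr, fun x => (hg x).1, fun x => (hg x).2⟩

lemma IsLeader.eq_of_iterate {f : V → V} {c d : V} (hc : IsLeader f c) (hd : IsLeader f d)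
    {k : ℕ} (h : f^[k] c = d) : c = d := by
  obtain ⟨l, hl⟩ := hc.1.exists_iterate_eq k
  refine le_antisymm (h ▸ hc.2 k) ?_
  rw [h] at hl
  exact hl ▸ hd.2 l

/-! ### Foata's transform of a parent function unfolds back to it -/

lemma IsParentFun.foata_iterate_mem {g : V → V} {c : V} (h : IsParentFun g c) (r : V) (k j : ℕ) :
    ∃ i, (foata g r)^[k] (g^[j] r) = g^[i] r ∧ pathMin g r i = pathMin g r j := by
  induction k generalizing j with
  | zero => exact ⟨j, rfl, rfl⟩
  | succ k ih =>
    rw [Function.iterate_succ_apply, h.foata_iterate]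
    split_ifs with hj
    · obtain ⟨i, -, hi, hi'⟩ := exists_pathMin_eq g r j
      obtain ⟨l, hl, hl'⟩ := ih i
      exact ⟨l, hi ▸ hl, hl'.trans hi'⟩
    · obtain ⟨l, hl, hl'⟩ := ih (j + 1)
      push Not at hj
      exact ⟨l, hl, hl'.trans (pathMin_succ_of_le hj.2)⟩

lemma IsParentFun.exists_foata_iterate_eq_pathMin {g : V → V} {c : V} (h : IsParentFun g c)
    (r : V) (j : ℕ) : ∃ k ≥ 1, (foata g r)^[k] (g^[j] r) = pathMin g r j := by
  obtain ⟨l, hl⟩ := h.2 (g^[j] r)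
  induction l generalizing j with
  | zero =>
    refine ⟨1, le_rfl, ?_⟩
    have : g^[j + 1] r = g^[j] r := by
      rw [Function.iterate_succ_apply', show g^[j] r = c from hl, h.1]
    rw [Function.iterate_one, h.foata_iterate, if_pos (Or.inl this)]
  | succ l ih =>
    by_cases hj : g^[j + 1] r = g^[j] r ∨ g^[j + 1] r < pathMin g r j
    · exact ⟨1, le_rfl, by rw [Function.iterate_one, h.foata_iterate, if_pos hj]⟩
    · obtain ⟨k, hk, hk'⟩ := ih (j + 1)
        (by rw [Function.iterate_succ_apply', ← Function.iterate_succ_apply]; exact hl)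
      refine ⟨k + 1, by omega, ?_⟩
      rw [Function.iterate_succ_apply, h.foata_iterate, if_neg hj, hk']
      push Not at hj
      exact pathMin_succ_of_le hj.2

lemma IsParentFun.exists_foata_iterate_pathMin_eq {g : V → V} {c : V} (h : IsParentFun g c)
    (r : V) (j : ℕ) : ∃ k, (foata g r)^[k] (pathMin g r j) = g^[j] r := by
  induction j with
  | zero => exact ⟨0, rfl⟩
  | succ j ih =>
    rcases lt_or_ge (g^[j + 1] r) (pathMin g r j) with hj | hj
    · exact ⟨0, pathMin_succ_of_lt hj⟩
    · rw [pathMin_succ_of_le hj]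
      obtain ⟨k, hk⟩ := ih
      by_cases he : g^[j + 1] r = g^[j] r
      · exact ⟨k, by rw [hk, he]⟩
      · refine ⟨k + 1, ?_⟩
        rw [Function.iterate_succ_apply', hk, h.foata_iterate, if_neg]
        exact not_or.2 ⟨he, hj.not_gt⟩

lemma IsParentFun.inCore_foata_iff {g : V → V} {c : V} (h : IsParentFun g c) {r x : V} :
    inCore (foata g r) x ↔ ∃ j, g^[j] r = x := by
  constructor
  · intro hx
    have key : ∀ l y, g^[l] y = c → ∃ k i, (foata g r)^[k] y = g^[i] r := by
      intro l
      induction l with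
      | zero =>
        intro y hy
        obtain ⟨j, hj⟩ := h.2 r
        exact ⟨0, j, hy.trans hj.symm⟩
      | succ l ih =>
        intro y hy
        by_cases hp : ∃ j, g^[j] r = y
        · obtain ⟨j, rfl⟩ := hp
          exact ⟨0, j, rfl⟩
        · obtain ⟨k, i, hk⟩ := ih (g y) hy
          exact ⟨k + 1, i, by rw [Function.iterate_succ_apply, foata_of_not_mem hp, hk]⟩
    obtain ⟨l, hl⟩ := h.2 x
    obtain ⟨k, i, hk⟩ := key l x hl
    obtain ⟨m, hm⟩ := hx.exists_iterate_eq k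
    rw [hk] at hm
    obtain ⟨n, hn, -⟩ := h.foata_iterate_mem r m i
    exact ⟨n, hn.symm.trans hm⟩
  · rintro ⟨j, rfl⟩
    obtain ⟨k, hk, hk'⟩ := h.exists_foata_iterate_eq_pathMin r j
    obtain ⟨l, hl⟩ := h.exists_foata_iterate_pathMin_eq r j
    exact ⟨l + k, by omega, by rw [Function.iterate_add_apply, hk', hl]⟩

lemma IsParentFun.isLeader_foata_iff {g : V → V} {c : V} (h : IsParentFun g c) {r x : V} :
    IsLeader (foata g r) x ↔ ∃ j, pathMin g r j = x := by
  constructor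
  · rintro ⟨hx, hmin⟩
    obtain ⟨j, rfl⟩ := h.inCore_foata_iff.1 hx
    obtain ⟨k, -, hk⟩ := h.exists_foata_iterate_eq_pathMin r j
    exact ⟨j, le_antisymm (pathMin_le_iterate g r j) (hk ▸ hmin k)⟩
  · rintro ⟨j, rfl⟩
    obtain ⟨i, -, hi, hi'⟩ := exists_pathMin_eq g r j
    refine ⟨h.inCore_foata_iff.2 ⟨i, hi⟩, fun k => ?_⟩
    obtain ⟨l, hl, hl'⟩ := h.foata_iterate_mem r k i
    rw [← hi, hl, hi, ← hi', ← hl']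
    exact pathMin_le_iterate g r l

lemma IsParentFun.foata_iterate_isLeader_iff {g : V → V} {c : V} (h : IsParentFun g c) (r : V)
    (j : ℕ) : IsLeader (foata g r) (foata g r (g^[j] r)) ↔
      g^[j + 1] r = g^[j] r ∨ g^[j + 1] r < pathMin g r j := by
  constructor
  · intro hl
    by_contra hj
    have he := h.foata_iterate r j
    rw [if_neg hj] at he
    rw [he] at hl
    obtain ⟨i, hi⟩ := h.isLeader_foata_iff.1 hl
    push Not at hj
    have hmin : pathMin g r j = g^[j + 1] r := by
      obtain ⟨k, -, hk⟩ := h.exists_foata_iterate_eq_pathMin r (j + 1)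
      rw [pathMin_succ_of_le hj.2] at hk
      exact le_antisymm hj.2 (hk ▸ hl.2 k)
    obtain ⟨l, hl, hl', -⟩ := exists_pathMin_eq g r j
    have hlc : g^[l] r = c := h.iterate_eq_root (j := j + 1) (by omega) (hl'.trans hmin)
    have hjc : g^[j] r = c := by
      rw [show j = (j - l) + l by omega, Function.iterate_add_apply, hlc, h.iterate_root]
    exact hj.1 (by rw [Function.iterate_succ_apply', hjc, h.1])
  · intro hj
    rw [h.foata_iterate, if_pos hj]
    exact h.isLeader_foata_iff.2 ⟨j, rfl⟩

lemma IsParentFun.isUnfolding_foata {g : V → V} {c : V} (h : IsParentFun g c) (r : V) :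
    IsUnfolding (foata g r) g r := by
  refine ⟨⟨h.isLeader_foata_iff.2 ⟨0, rfl⟩, ?_⟩, ?_, ?_⟩
  · intro x hx
    obtain ⟨j, rfl⟩ := h.isLeader_foata_iff.1 hx
    exact pathMin_antitone g r (Nat.zero_le j)
  · intro x hx
    by_cases hp : ∃ j, g^[j] r = x
    · obtain ⟨j, rfl⟩ := hp
      rw [h.foata_iterate_isLeader_iff] at hx
      rw [h.foata_iterate, if_neg fun hj => hx ⟨h.inCore_foata_iff.2 ⟨j, rfl⟩, hj⟩,
        Function.iterate_succ_apply']
    · exact (foata_of_not_mem hp).symm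
  · intro x hx hl
    obtain ⟨j, rfl⟩ := h.inCore_foata_iff.1 hx
    rw [h.foata_iterate_isLeader_iff] at hl
    rw [h.foata_iterate, if_pos hl, ← Function.iterate_succ_apply' g]
    by_cases hj : g^[j + 1] r = g^[j] r
    · refine Or.inr ⟨fun d hd => ?_, hj⟩
      obtain ⟨i, rfl⟩ := h.isLeader_foata_iff.1 hd
      rcases le_total i j with hij | hij
      · exact pathMin_antitone g r hij
      · exact (h.pathMin_eq_of_root (h.iterate_eq_root (Nat.lt_succ_self j) hj.symm) hij).ge
    · have hlt := hl.resolve_left hj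
      refine Or.inl ⟨⟨h.isLeader_foata_iff.2 ⟨j + 1, pathMin_succ_of_lt hlt⟩, hlt⟩, ?_⟩
      rintro d ⟨hd, hdj⟩
      obtain ⟨i, rfl⟩ := h.isLeader_foata_iff.1 hd
      rw [← pathMin_succ_of_lt hlt]
      refine pathMin_antitone g r (Nat.succ_le_of_lt (not_le.1 fun hij => ?_))
      exact (pathMin_antitone g r hij).not_gt hdj

/-! ### An unfolding is a parent function, and Foata's transform recovers the map -/

namespace IsUnfolding

variable {f g : V → V} {r : V}

lemma iterate_spec (h : IsUnfolding f g r) (j : ℕ) :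
    IsLeader f (pathMin g r j) ∧ ∃ k, f^[k] (pathMin g r j) = g^[j] r := by
  induction j with
  | zero => exact ⟨h.greatest.1, 0, rfl⟩
  | succ j ih =>
    obtain ⟨hl, k, hk⟩ := ih
    have hc : inCore f (g^[j] r) := hk ▸ hl.1.iterate k
    by_cases hx : IsLeader f (f (g^[j] r))
    · have he : pathMin g r j = f (g^[j] r) :=
        hl.eq_of_iterate hx (k := k + 1) (by rw [Function.iterate_succ_apply', hk])
      rcases h.next _ hc hx with hn | ⟨-, hn⟩
      · rw [← Function.iterate_succ_apply' g, ← he] at hn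
        rw [pathMin_succ_of_lt hn.1.2]
        exact ⟨hn.1.1, 0, rfl⟩
      · rw [← Function.iterate_succ_apply' g] at hn
        rw [pathMin_succ_of_le (hn ▸ pathMin_le_iterate g r j), hn]
        exact ⟨hl, k, hk⟩
    · have he : g^[j + 1] r = f^[k + 1] (pathMin g r j) := by
        rw [Function.iterate_succ_apply', h.eq_of_not _ fun h' => hx h'.2,
          Function.iterate_succ_apply', hk]
      rw [pathMin_succ_of_le (he ▸ hl.2 _)]
      exact ⟨hl, k + 1, he.symm⟩

lemma inCore_iterate (h : IsUnfolding f g r) (j : ℕ) : inCore f (g^[j] r) := by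
  obtain ⟨hl, k, hk⟩ := h.iterate_spec j
  exact hk ▸ hl.1.iterate k

lemma pathMin_eq (h : IsUnfolding f g r) {j : ℕ} (hx : IsLeader f (f (g^[j] r))) :
    pathMin g r j = f (g^[j] r) := by
  obtain ⟨hl, k, hk⟩ := h.iterate_spec j
  exact hl.eq_of_iterate hx (k := k + 1) (by rw [Function.iterate_succ_apply', hk])

lemma exists_iterate_inCore [Finite V] (h : IsUnfolding f g r) (x : V) :
    ∃ k, inCore f (g^[k] x) := by
  obtain ⟨j, hj⟩ := exists_inCore_iterate f x
  induction j generalizing x with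
  | zero => exact ⟨0, hj⟩
  | succ j ih =>
    by_cases hx : inCore f x
    · exact ⟨0, hx⟩
    · obtain ⟨k, hk⟩ := ih (f x) hj
      refine ⟨k + 1, ?_⟩
      rwa [Function.iterate_succ_apply, h.eq_of_not x fun h' => hx h'.1]

lemma exists_iterate_isLeader (h : IsUnfolding f g r) {x : V} (hx : inCore f x) {k : ℕ}
    (hk : IsLeader f (f^[k + 1] x)) :
    ∃ l m, inCore f (g^[l] x) ∧ f (g^[l] x) = f^[m] x ∧ IsLeader f (f (g^[l] x)) := by
  induction k generalizing x with
  | zero => exact ⟨0, 1, hx, rfl, hk⟩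
  | succ k ih =>
    by_cases hl : IsLeader f (f x)
    · exact ⟨0, 1, hx, rfl, hl⟩
    · obtain ⟨l, m, h1, h2, h3⟩ := ih (x := f x) (hx.iterate 1) hk
      refine ⟨l + 1, m + 1, ?_⟩
      rw [Function.iterate_succ_apply, h.eq_of_not x fun h' => hl h'.2]
      exact ⟨h1, h2, h3⟩

lemma exists_iterate_fixed_of_isLeader [Finite V] (h : IsUnfolding f g r) {d : V}
    (hd : IsLeader f d) :
    ∃ l, inCore f (g^[l] d) ∧ (∀ c, IsLeader f c → f (g^[l] d) ≤ c) ∧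
      IsLeader f (f (g^[l] d)) ∧ g (g^[l] d) = g^[l] d := by
  induction d using WellFoundedLT.induction with
  | ind d ih =>
    obtain ⟨k, hk⟩ := (hd.1.iterate 1).exists_isLeader
    obtain ⟨l, m, hc, hm, hl⟩ := h.exists_iterate_isLeader (k := k) hd.1 hk
    have he : d = f (g^[l] d) := hd.eq_of_iterate hl hm.symm
    rcases h.next _ hc hl with hn | ⟨hn, hn'⟩
    · obtain ⟨i, hi⟩ := ih _ (hn.1.2.trans_eq he.symm) hn.1.1
      refine ⟨i + (l + 1), ?_⟩
      rwa [Function.iterate_add_apply, Function.iterate_succ_apply']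
    · exact ⟨l, hc, hn, hl, hn'⟩

lemma exists_iterate_fixed [Finite V] (h : IsUnfolding f g r) (x : V) :
    ∃ l, inCore f (g^[l] x) ∧ (∀ c, IsLeader f c → f (g^[l] x) ≤ c) ∧
      IsLeader f (f (g^[l] x)) ∧ g (g^[l] x) = g^[l] x := by
  obtain ⟨j, hj⟩ := h.exists_iterate_inCore x
  obtain ⟨k, hk⟩ := (hj.iterate 1).exists_isLeader
  obtain ⟨l, -, hc, -, hl⟩ := h.exists_iterate_isLeader (k := k) hj hk
  rw [← Function.iterate_add_apply] at hc hl
  rcases h.next _ hc hl with hn | ⟨hn, hn'⟩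
  · obtain ⟨i, hi⟩ := h.exists_iterate_fixed_of_isLeader hn.1.1
    refine ⟨i + (l + j + 1), ?_⟩
    rwa [Function.iterate_add_apply, Function.iterate_succ_apply']
  · exact ⟨l + j, hc, hn, hl, hn'⟩

lemma isParentFun [Finite V] (h : IsUnfolding f g r) : ∃ c, IsParentFun g c := by
  obtain ⟨l, hc, hn, hl, hf⟩ := h.exists_iterate_fixed r
  refine ⟨g^[l] r, hf, fun x => ?_⟩
  obtain ⟨k, hc', hn', hl', -⟩ := h.exists_iterate_fixed x
  exact ⟨k, hc'.eq_of_apply_eq hc (le_antisymm (hn' _ hl) (hn _ hl'))⟩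

lemma iterate_mem_path (h : IsUnfolding f g r) {c : V} (hc : IsLeader f c)
    (hp : ∃ j, g^[j] r = c) (k : ℕ) : ∃ j, g^[j] r = f^[k] c := by
  induction k with
  | zero => exact hp
  | succ k ih =>
    rw [Function.iterate_succ_apply']
    by_cases hl : IsLeader f (f (f^[k] c))
    · rw [← hc.eq_of_iterate hl (k := k + 1) (Function.iterate_succ_apply' ..)]
      exact hp
    · obtain ⟨j, hj⟩ := ih
      refine ⟨j + 1, ?_⟩
      rw [Function.iterate_succ_apply', hj, h.eq_of_not _ fun h' => hl h'.2]

lemma isLeader_mem_path [Finite V] (h : IsUnfolding f g r) {c : V} (hc : IsLeader f c) :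
    ∃ j, g^[j] r = c := by
  induction c using WellFoundedGT.induction with
  | ind c ih =>
    rcases (h.greatest.2 hc).eq_or_lt with rfl | hcr
    · exact ⟨0, rfl⟩
    · obtain ⟨d, ⟨hd, hcd⟩, hmin⟩ := Set.exists_min_image {d | IsLeader f d ∧ c < d} id
        (Set.toFinite _) ⟨r, h.greatest.1, hcr⟩
      obtain ⟨k, hk⟩ := hd.1.exists_iterate_eq 1
      obtain ⟨j, hj⟩ := h.iterate_mem_path hd (ih d hcd hd) k
      have hfd : f (f^[k] d) = d := by
        rwa [← Function.iterate_succ_apply' f, Function.iterate_succ_apply]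
      refine ⟨j + 1, ?_⟩
      rw [Function.iterate_succ_apply', hj]
      rcases h.next _ (hd.1.iterate k) (hfd.symm ▸ hd) with hn | ⟨hn, -⟩
      · rw [hfd] at hn
        refine (hn.2 ⟨hc, hcd⟩).eq_or_lt.elim Eq.symm fun hlt => ?_
        exact absurd hn.1.2 (hmin _ ⟨hn.1.1, hlt⟩).not_gt
      · rw [hfd] at hn
        exact absurd hcd (hn c hc).not_gt

lemma inCore_mem_path [Finite V] (h : IsUnfolding f g r) {x : V} (hx : inCore f x) :
    ∃ j, g^[j] r = x := by
  obtain ⟨k, hk⟩ := hx.exists_isLeader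
  obtain ⟨l, hl⟩ := hx.exists_iterate_eq k
  exact hl ▸ h.iterate_mem_path hk (h.isLeader_mem_path hk) l

lemma foata_eq [Finite V] (h : IsUnfolding f g r) : foata g r = f := by
  obtain ⟨c, hg⟩ := h.isParentFun
  funext x
  by_cases hp : ∃ j, g^[j] r = x
  · obtain ⟨j, rfl⟩ := hp
    have hc := h.inCore_iterate j
    rw [hg.foata_iterate]
    by_cases hl : IsLeader f (f (g^[j] r))
    · rw [if_pos, h.pathMin_eq hl]
      rw [h.pathMin_eq hl, Function.iterate_succ_apply']
      exact (h.next _ hc hl).symm.imp And.right fun hn => hn.1.2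
    · have he : g^[j + 1] r = f (g^[j] r) := by
        rw [Function.iterate_succ_apply', h.eq_of_not _ fun h' => hl h'.2]
      rw [if_neg, he]
      rintro (hj | hj)
      · have hfix : f (g^[j] r) = g^[j] r := he.symm.trans hj
        refine hl ?_
        rw [hfix]
        exact ⟨hc, fun k => (Function.iterate_fixed hfix k).ge⟩
      · obtain ⟨hm, k, hk⟩ := h.iterate_spec j
        rw [he, ← hk, ← Function.iterate_succ_apply' f] at hj
        exact (hm.2 _).not_gt hj
  · rw [foata_of_not_mem hp, h.eq_of_not x fun h' => hp (h.inCore_mem_path h'.1)]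

end IsUnfolding
lemma foata_eq_of_ne {g : V → V} {c r x : V} (h : IsParentFun g c) (hx : foata g r x ≠ g x) :
    ∃ j, g^[j] r = x ∧ foata g r x = pathMin g r j ∧ (g x = x ∨ g x < pathMin g r j) := by
  by_cases hp : ∃ j, g^[j] r = x
  · obtain ⟨j, rfl⟩ := hp
    rw [h.foata_iterate, ← Function.iterate_succ_apply' g] at hx ⊢
    split_ifs at hx ⊢ with hj
    · exact ⟨j, rfl, rfl, hj⟩
    · exact absurd rfl hx
  · exact absurd (foata_of_not_mem hp) hx

lemma foata_eq_of_mem_isLowerSet {g : V → V} {c r x : V} (h : IsParentFun g c) {S : Set V}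
    (hS : IsLowerSet S) (hg : ∀ x ∈ S, g x ∉ S) (hx : x ∈ S) : foata g r x = g x := by
  by_contra hne
  obtain ⟨j, rfl, -, hj | hj⟩ := foata_eq_of_ne h hne
  · exact hg _ hx (hj.symm ▸ hx)
  · exact hg _ hx (hS (hj.le.trans (pathMin_le_iterate g r j)) hx)

lemma foata_not_mem_iff {g : V → V} {c r : V} (h : IsParentFun g c) {S : Set V}
    (hS : IsLowerSet S) : (∀ x ∈ S, foata g r x ∉ S) ↔ ∀ x ∈ S, g x ∉ S := by
  refine ⟨fun hf x hx hgx => ?_, fun hg x hx => ?_⟩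
  · by_cases hne : foata g r x = g x
    · exact hf x hx (hne ▸ hgx)
    · obtain ⟨j, rfl, hj, -⟩ := foata_eq_of_ne h hne
      exact hf _ hx (hj ▸ hS (pathMin_le_iterate g r j) hx)
  · rw [foata_eq_of_mem_isLowerSet h hS hg hx]
    exact hg x hx

lemma subsingleton_foata_not_mem_and_mem {g : V → V} {c r : V} (h : IsParentFun g c) {S : Set V}
    (hS : IsLowerSet S) : {x | x ∉ S ∧ foata g r x ∉ S ∧ g x ∈ S}.Subsingleton := by
  have key : ∀ x ∈ {x | x ∉ S ∧ foata g r x ∉ S ∧ g x ∈ S},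
      ∃ j, g^[j] r = x ∧ pathMin g r j ∉ S ∧ g^[j + 1] r ∈ S := by
    rintro x ⟨-, hf, hg⟩
    obtain ⟨j, rfl, hj, -⟩ := foata_eq_of_ne h fun he => hf (he ▸ hg)
    exact ⟨j, rfl, hj ▸ hf, by rwa [Function.iterate_succ_apply']⟩
  intro x hx y hy
  obtain ⟨i, rfl, hi, hi'⟩ := key x hx
  obtain ⟨j, rfl, hj, hj'⟩ := key y hy
  have le_of : ∀ {a b : ℕ}, pathMin g r b ∉ S → g^[a + 1] r ∈ S → b ≤ a := by
    intro a b hb ha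
    by_contra! hab
    exact hb (hS ((pathMin_antitone g r hab).trans (pathMin_le_iterate g r _)) ha)
  rw [le_antisymm (le_of hi hj') (le_of hj hi')]

lemma subsingleton_foata_mem_and_not_mem {g : V → V} {c r : V} (h : IsParentFun g c) {S : Set V}
    (hS : IsLowerSet S) : {x | foata g r x ∈ S ∧ g x ∉ S}.Subsingleton := by
  have key : ∀ x ∈ {x | foata g r x ∈ S ∧ g x ∉ S}, x = c := by
    rintro x ⟨hf, hg⟩
    obtain ⟨j, -, hj, hj' | hj'⟩ := foata_eq_of_ne h fun he => hg (he ▸ hf)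
    · exact h.eq_root le_rfl hj'
    · exact absurd (hS hj'.le (hj ▸ hf)) hg
  exact fun x hx y hy => (key x hx).trans (key y hy).symm

end Foata

lemma Set.abs_ncard_sub_ncard_le_one {α : Type*} [Finite α] {s t : Set α}
    (h : (s \ t).Subsingleton) (h' : (t \ s).Subsingleton) :
    |(s.ncard : ℤ) - (t.ncard : ℤ)| ≤ 1 := by
  have h1 := Set.ncard_le_ncard_sdiff_add_ncard s t
  have h2 := Set.ncard_le_ncard_sdiff_add_ncard t s
  have h3 := Set.ncard_le_one_iff_subsingleton.2 h
  have h4 := Set.ncard_le_one_iff_subsingleton.2 h'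
  rw [abs_le]
  omega

lemma isLowerSet_val_lt (n k : ℕ) : IsLowerSet {x : Fin n | (x : ℕ) < k} :=
  fun _ _ hyx hx => Set.mem_ofPred.2 (lt_of_le_of_lt (Fin.le_def.1 hyx) hx)

lemma abs_NSfun_sub_NSfun_foata_le_one {n k : ℕ} {g : Fin n → Fin n} {c r : Fin n}
    (h : IsParentFun g c) (hg : ∀ x : Fin n, (x : ℕ) < k → k ≤ (g x : ℕ)) :
    |(NSfun n k g : ℤ) - (NSfun n k (foata g r) : ℤ)| ≤ 1 := by
  have hS := isLowerSet_val_lt n k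
  have hfg : ∀ s : Fin n, (s : ℕ) < k → foata g r s = g s := fun s hs =>
    foata_eq_of_mem_isLowerSet h hS (fun x hx => not_lt.2 (hg x hx)) hs
  refine Set.abs_ncard_sub_ncard_le_one ?_ ?_
  · refine (subsingleton_foata_mem_and_not_mem (r := r) h hS).anti ?_
    rintro x ⟨⟨h1, h2, h3⟩, h4⟩
    refine ⟨?_, not_lt.2 h2⟩
    by_contra h5
    exact h4 ⟨h1, not_lt.1 h5, fun s hs => hfg s hs ▸ h3 s hs⟩
  · refine (subsingleton_foata_not_mem_and_mem (r := r) h hS).anti ?_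
    rintro x ⟨⟨h1, h2, h3⟩, h4⟩
    refine ⟨not_lt.2 h1, not_lt.2 h2, ?_⟩
    by_contra h5
    exact h4 ⟨h1, not_lt.1 h5, fun s hs => hfg s hs ▸ h3 s hs⟩

section ParentGraph

variable {V : Type*}

/-- The graph joining each `x` to `g x`, without loops. -/
def parentGraph (g : V → V) : SimpleGraph V := SimpleGraph.fromRel fun x y => g x = y

lemma parentGraph_adj {g : V → V} {x y : V} :
    (parentGraph g).Adj x y ↔ x ≠ y ∧ (g x = y ∨ g y = x) := SimpleGraph.fromRel_adj ..

lemma parentGraph_reachable_iterate (g : V → V) (x : V) (j : ℕ) :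
    (parentGraph g).Reachable x (g^[j] x) := by
  induction j with
  | zero => exact .refl _
  | succ j ih =>
    rw [Function.iterate_succ_apply']
    by_cases hx : g^[j] x = g (g^[j] x)
    · rwa [← hx]
    · exact ih.trans (parentGraph_adj.2 ⟨hx, .inl rfl⟩).reachable

namespace IsParentFun

lemma connected_parentGraph {g : V → V} {c : V} (h : IsParentFun g c) :
    (parentGraph g).Connected := by
  have hc : ∀ x, (parentGraph g).Reachable x c := fun x => by
    obtain ⟨j, hj⟩ := h.2 x
    exact hj ▸ parentGraph_reachable_iterate g x j
  have : Nonempty V := ⟨c⟩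
  exact ⟨fun x y => (hc x).trans (hc y).symm⟩

lemma isTree_parentGraph [Finite V] {g : V → V} {c : V} (h : IsParentFun g c) :
    (parentGraph g).IsTree := by
  refine SimpleGraph.isTree_iff_connected_and_card.2 ⟨h.connected_parentGraph,
    le_antisymm ?_ h.connected_parentGraph.card_vert_le_card_edgeSet_add_one⟩
  have hsub : (parentGraph g).edgeSet ⊆ (fun x => s(x, g x)) '' {c}ᶜ := by
    intro e
    induction e with
    | _ x y =>
      rw [SimpleGraph.mem_edgeSet, parentGraph_adj]
      rintro ⟨hne, rfl | rfl⟩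
      · exact ⟨x, fun hx => hne (by rw [show x = c from hx, h.1]), rfl⟩
      · exact ⟨y, fun hy => hne (by rw [show y = c from hy, h.1]), Sym2.eq_swap⟩
  have h1 := (Set.ncard_le_ncard hsub (Set.toFinite _)).trans (Set.ncard_image_le (Set.toFinite _))
  have h2 := Set.ncard_add_ncard_compl ({c} : Set V)
  rw [Set.ncard_singleton] at h2
  rw [Nat.card_coe_set_eq]
  omega

lemma eq_of_parentGraph_eq {g g' : V → V} {c : V} (h : IsParentFun g c) (h' : IsParentFun g' c)
    (he : parentGraph g = parentGraph g') : g = g' := by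
  funext x
  obtain ⟨j, hj⟩ := h.2 x
  induction j generalizing x with
  | zero =>
    obtain rfl : x = c := hj
    rw [h.1, h'.1]
  | succ j ih =>
    by_cases hx : g x = x
    · rw [h.eq_root le_rfl hx, h.1, h'.1]
    · have hadj : (parentGraph g').Adj x (g x) :=
        he ▸ parentGraph_adj.2 ⟨Ne.symm hx, .inl rfl⟩
      refine (parentGraph_adj.1 hadj).2.elim Eq.symm fun hgx => ?_
      have hxc : x = c := h.eq_root (m := 2) (by omega) ((ih (g x) hj).trans hgx)
      rw [hxc, h.1, h'.1]

end IsParentFun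

lemma SimpleGraph.Connected.exists_adj_dist_succ {G : SimpleGraph V} (h : G.Connected) {x c : V}
    (hx : x ≠ c) : ∃ y, G.Adj x y ∧ G.dist y c < G.dist x c := by
  obtain ⟨p, hp⟩ := h.exists_walk_length_eq_dist x c
  cases p with
  | nil => exact absurd rfl hx
  | cons hadj q =>
    refine ⟨_, hadj, ?_⟩
    rw [← hp, SimpleGraph.Walk.length_cons, Nat.lt_succ_iff]
    exact SimpleGraph.dist_le q

lemma SimpleGraph.IsTree.exists_isParentFun {G : SimpleGraph V} (h : G.IsTree) (c : V) :
    ∃ g, IsParentFun g c ∧ parentGraph g = G := by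
  have hex : ∀ x, ∃ y, (x = c → y = c) ∧ (x ≠ c → G.Adj x y ∧ G.dist y c < G.dist x c) := by
    intro x
    by_cases hx : x = c
    · exact ⟨c, fun _ => rfl, fun h' => absurd hx h'⟩
    · obtain ⟨y, hy⟩ := h.connected.exists_adj_dist_succ hx
      exact ⟨y, fun h' => absurd h' hx, fun _ => hy⟩
  choose g hg hg' using hex
  have hpar : IsParentFun g c := by
    refine ⟨hg c rfl, fun x => ?_⟩
    induction hd : G.dist x c using Nat.strong_induction_on generalizing x with
    | _ d ih =>
      by_cases hx : x = c
      · exact ⟨0, hx⟩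
      · obtain ⟨j, hj⟩ := ih _ (hd ▸ (hg' x hx).2) (g x) rfl
        exact ⟨j + 1, hj⟩
  have hle : parentGraph g ≤ G := by
    intro x y hxy
    obtain ⟨hne, rfl | rfl⟩ := parentGraph_adj.1 hxy
    · exact (hg' x fun hx => hne (by rw [hx, hg c rfl])).1
    · exact (hg' y fun hy => hne (by rw [hy, hg c rfl])).1.symm
  exact ⟨g, hpar, le_antisymm hle
    ((SimpleGraph.isTree_iff_minimal_connected.1 h).2 hpar.connected_parentGraph hle)⟩

end ParentGraph

lemma NStree_parentGraph {n k : ℕ} (g : Fin n → Fin n) :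
    NStree n k (parentGraph g) = NSfun n k g := by
  refine congrArg Set.ncard (Set.ext fun x => and_congr_right fun hx => ?_)
  simp only [parentGraph_adj]
  constructor
  · refine fun h => ⟨not_lt.1 fun hgx => h (g x) hgx ⟨?_, .inl rfl⟩,
      fun s hs hsx => h s hs ⟨?_, .inr hsx⟩⟩
    · exact fun he => absurd hgx (he ▸ hx.not_gt)
    · exact fun he => absurd hs (he ▸ hx.not_gt)
  · rintro ⟨h1, h2⟩ s hs ⟨-, rfl | h3⟩
    · exact h1.not_gt hs
    · exact h2 s hs h3

lemma parentGraph_independent_iff {n k : ℕ} {g : Fin n → Fin n} {c : Fin n}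
    (h : IsParentFun g c) :
    ((∀ x y : Fin n, (x : ℕ) < k → (y : ℕ) < k → ¬ (parentGraph g).Adj x y) ∧ k ≤ (c : ℕ)) ↔
      ∀ x : Fin n, (x : ℕ) < k → k ≤ (g x : ℕ) := by
  constructor
  · rintro ⟨h1, h2⟩ x hx
    by_contra! hgx
    refine h1 x (g x) hx hgx (parentGraph_adj.2 ⟨fun he => ?_, .inl rfl⟩)
    rw [h.eq_root (m := 1) le_rfl he.symm] at hx
    omega
  · refine fun hg => ⟨fun x y hx hy hadj => ?_, ?_⟩
    · obtain ⟨-, rfl | rfl⟩ := parentGraph_adj.1 hadj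
      · exact (hg x hx).not_gt hy
      · exact (hg y hy).not_gt hx
    · by_contra! hc
      have := hg c hc
      rw [h.1] at this
      omega

/-- A parent function respecting the constraint on `{x | (x : ℕ) < k}`, with its root and a
second marked point. -/
structure RestrictedParentFun (n k : ℕ) where
  toFun : Fin n → Fin n
  root : Fin n
  mark : Fin n
  isParentFun : IsParentFun toFun root
  le_apply : ∀ x : Fin n, (x : ℕ) < k → k ≤ (toFun x : ℕ)

namespace RestrictedParentFun

variable {n k : ℕ}

/-- The doubly rooted tree of a parent function. -/
def toTree (p : RestrictedParentFun n k) : {T : DoublyRootedTree n //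
    (∀ x y : Fin n, (x : ℕ) < k → (y : ℕ) < k → ¬ T.tree.Adj x y) ∧ k ≤ (T.r2 : ℕ)} :=
  ⟨⟨parentGraph p.toFun, p.isParentFun.isTree_parentGraph, p.mark, p.root⟩,
    (parentGraph_independent_iff p.isParentFun).2 p.le_apply⟩

lemma toTree_bijective : Function.Bijective (toTree (n := n) (k := k)) := by
  constructor
  · rintro ⟨g, c, r, h, hg⟩ ⟨g', c', r', h', hg'⟩ he
    simp only [toTree, Subtype.mk.injEq, DoublyRootedTree.mk.injEq] at he
    obtain ⟨he, rfl, rfl⟩ := he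
    obtain rfl := h.eq_of_parentGraph_eq h' he
    rfl
  · rintro ⟨⟨T, hT, r, c⟩, hS⟩
    obtain ⟨g, hg, rfl⟩ := hT.exists_isParentFun c
    exact ⟨⟨g, c, r, hg, (parentGraph_independent_iff hg).1 hS⟩, rfl⟩

/-- Foata's transform as a map to the restricted self-maps. -/
noncomputable def toSelfMap (p : RestrictedParentFun n k) :
    {f : Fin n → Fin n // ∀ x : Fin n, (x : ℕ) < k → k ≤ (f x : ℕ)} :=
  ⟨foata p.toFun p.mark, fun x hx => not_lt.1 ((foata_not_mem_iff p.isParentFun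
    (isLowerSet_val_lt n k)).2 (fun y hy => not_lt.2 (p.le_apply y hy)) x hx)⟩

lemma toSelfMap_bijective (hn : 0 < n) : Function.Bijective (toSelfMap (n := n) (k := k)) := by
  constructor
  · rintro ⟨g, c, r, h, hg⟩ ⟨g', c', r', h', hg'⟩ he
    simp only [toSelfMap, Subtype.mk.injEq] at he
    obtain ⟨rfl, rfl⟩ := (h.isUnfolding_foata r).unique (he ▸ h'.isUnfolding_foata r')
    obtain rfl := h.root_unique h'
    rfl
  · rintro ⟨f, hf⟩
    have : Nonempty (Fin n) := ⟨⟨0, hn⟩⟩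
    obtain ⟨g, r, h⟩ := exists_isUnfolding f
    obtain ⟨c, hc⟩ := h.isParentFun
    obtain rfl := h.foata_eq
    exact ⟨⟨g, c, r, hc, fun x hx => not_lt.1 ((foata_not_mem_iff hc
      (isLowerSet_val_lt n k)).1 (fun y hy => not_lt.2 (hf y hy)) x hx)⟩, rfl⟩

end RestrictedParentFun

theorem renyi_joyal_restricted_not_connected_count (n k : ℕ) (hk : 1 ≤ k) (hkn : k < n) :
    ∃ R : {f : Fin n → Fin n // ∀ x : Fin n, (x : ℕ) < k → k ≤ (f x : ℕ)} ≃
        {T : DoublyRootedTree n //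
          (∀ x y : Fin n, (x : ℕ) < k → (y : ℕ) < k → ¬ T.tree.Adj x y) ∧
          k ≤ (T.r2 : ℕ)},
      ∀ f : {f : Fin n → Fin n // ∀ x : Fin n, (x : ℕ) < k → k ≤ (f x : ℕ)},
        |(NStree n k (R f).1.tree : ℤ) - (NSfun n k f.1 : ℤ)| ≤ 1 := by
  have hn : 0 < n := by omega
  let A := Equiv.ofBijective _ (RestrictedParentFun.toSelfMap_bijective (k := k) hn)
  let B := Equiv.ofBijective _ (RestrictedParentFun.toTree_bijective (n := n) (k := k))
  refine ⟨A.symm.trans B, fun f => ?_⟩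
  obtain ⟨p, rfl⟩ := A.surjective f
  rw [Equiv.trans_apply, Equiv.symm_apply_apply]
  change |(NStree n k (parentGraph p.toFun) : ℤ) - (NSfun n k (foata p.toFun p.mark) : ℤ)| ≤ 1
  rw [NStree_parentGraph]
  exact abs_NSfun_sub_NSfun_foata_le_one p.isParentFun p.le_apply
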